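/- arXiv:2508.08187 — 4 statements merged into one kernel-verified Lean document; each statement's English description precedes it below -/
import Mathlib

section
/- Let ψ be a bidding DER (p(ψ) < 0) connected at bus i and let α(ψ) ∈ [0,1] be its clearing fraction. Suppose there exist multipliers μ⁺ ≥ 0, μ⁻ ≥ 0 for the constraints α(ψ) ≤ 1 and α(ψ) ≥ 0 such that the KKT stationarity condition π(ψ)·(Σ_{φ∈Φ(ψ)} p^φ(ψ))·S_base·Δt + Σ_{φ∈Φ(ψ)} p^φ(ψ)·(λ^p_{i,φ} + η(ψ)·λ^q_{i,φ}) + μ⁺ − μ⁻ = 0 and the complementary slackness condition μ⁻·α(ψ) = 0 hold. If the bid is qualified, i.e., α(ψ) > 0, then π^QP(ψ) ≤ π(ψ), where π^QP(ψ) := Σ_{φ∈Φ(ψ)} (−λ^p_{i,φ} − η(ψ)·λ^q_{i,φ}) / (N_φ·S_base·Δt). -/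
/-- For a bidding DER (`pψ < 0`) with clearing fraction `α ∈ [0,1]`,
if KKT stationarity and complementary slackness hold and the bid is qualified
(`α > 0`), then the qualification price is at most the bid price. -/
theorem qualified_bid_price_ge_qualification_price
    (Φ : Finset (Fin 3)) (hΦ : Φ.Nonempty)
    (piψ pψ Sbase Δt η : ℝ)
    (lamP lamQ : Fin 3 → ℝ)
    (hbid : pψ < 0) (hpi : 0 ≤ piψ) (hS : 0 < Sbase) (hΔt : 0 < Δt) (hη : 0 ≤ η)
    (pphase : Fin 3 → ℝ)
    (hpphase : ∀ φ : Fin 3, pphase φ =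
      if φ ∈ Φ then pψ / (Sbase * (Φ.card : ℝ)) else 0)
    (α μplus μminus : ℝ)
    (hα0 : 0 ≤ α) (hα1 : α ≤ 1) (hμplus : 0 ≤ μplus) (hμminus : 0 ≤ μminus)
    (hstat : piψ * (∑ φ ∈ Φ, pphase φ) * Sbase * Δt
        + ∑ φ ∈ Φ, pphase φ * (lamP φ + η * lamQ φ) + μplus - μminus = 0)
    (hcs : μminus * α = 0)
    (hqual : 0 < α) :
    (∑ φ ∈ Φ, (-lamP φ - η * lamQ φ)) / ((Φ.card : ℝ) * Sbase * Δt) ≤ piψ := by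
  have hN : (0 : ℝ) < Φ.card := by exact_mod_cast hΦ.card_pos
  have hμ : μminus = 0 := (mul_eq_zero.mp hcs).resolve_right hqual.ne'
  have hk : pψ / (Sbase * (Φ.card : ℝ)) < 0 := div_neg_of_neg_of_pos hbid (mul_pos hS hN)
  set k := pψ / (Sbase * (Φ.card : ℝ))
  have hp : ∀ φ ∈ Φ, pphase φ = k := fun φ hφ => by rw [hpphase, if_pos hφ]
  have hsum : ∑ φ ∈ Φ, pphase φ = Φ.card * k := by
    rw [Finset.sum_congr rfl hp, Finset.sum_const, nsmul_eq_mul]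
  have hlam : ∑ φ ∈ Φ, pphase φ * (lamP φ + η * lamQ φ)
      = k * ∑ φ ∈ Φ, (lamP φ + η * lamQ φ) := by
    rw [Finset.mul_sum]
    exact Finset.sum_congr rfl fun φ hφ => by rw [hp φ hφ]
  have hneg : ∑ φ ∈ Φ, (-lamP φ - η * lamQ φ) = -∑ φ ∈ Φ, (lamP φ + η * lamQ φ) := by
    rw [← Finset.sum_neg_distrib]
    exact Finset.sum_congr rfl fun φ _ => by ring
  rw [hsum, hlam, hμ] at hstat
  rw [div_le_iff₀ (by positivity), hneg]
  have hnonneg : 0 ≤ piψ * (Φ.card * Sbase * Δt) + ∑ φ ∈ Φ, (lamP φ + η * lamQ φ) :=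
    nonneg_of_mul_nonpos_right (by linarith) hk
  linarith
end

section
/- Let ψ be an offering DER (p(ψ) > 0) connected at bus i, let M be a real number, and let α(ψ) ∈ [0,1] be its clearing fraction. Suppose there exist multipliers μ⁺ ≥ 0, μ⁻ ≥ 0 for the constraints α(ψ) ≤ 1 and α(ψ) ≥ 0 such that the KKT stationarity condition (π(ψ) − M/p(ψ))·(Σ_{φ∈Φ(ψ)} p^φ(ψ))·S_base·Δt + Σ_{φ∈Φ(ψ)} p^φ(ψ)·(λ^p_{i,φ} + η(ψ)·λ^q_{i,φ}) + μ⁺ − μ⁻ = 0 and the complementary slackness condition μ⁻·α(ψ) = 0 hold. If the offer is qualified, i.e., α(ψ) > 0, then π(ψ) ≤ π^QP(ψ), where π^QP(ψ) := M/p(ψ) + Σ_{φ∈Φ(ψ)} (−λ^p_{i,φ} − η(ψ)·λ^q_{i,φ}) / (N_φ·S_base·Δt). -/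
/-- For an offering DER (`pψ > 0`) with clearing fraction `α ∈ [0,1]`,
if KKT stationarity and complementary slackness hold and the offer is qualified
(`α > 0`), then the offer price is at most the qualification price. -/
theorem qualified_offer_price_le_qualification_price
    (Φ : Finset (Fin 3)) (hΦ : Φ.Nonempty)
    (piψ pψ Sbase Δt η M : ℝ)
    (lamP lamQ : Fin 3 → ℝ)
    (hoffer : 0 < pψ) (hpi : 0 ≤ piψ) (hS : 0 < Sbase) (hΔt : 0 < Δt) (hη : 0 ≤ η)
    (pphase : Fin 3 → ℝ)
    (hpphase : ∀ φ : Fin 3, pphase φ =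
      if φ ∈ Φ then pψ / (Sbase * (Φ.card : ℝ)) else 0)
    (α μplus μminus : ℝ)
    (hα0 : 0 ≤ α) (hα1 : α ≤ 1) (hμplus : 0 ≤ μplus) (hμminus : 0 ≤ μminus)
    (hstat : (piψ - M / pψ) * (∑ φ ∈ Φ, pphase φ) * Sbase * Δt
        + ∑ φ ∈ Φ, pphase φ * (lamP φ + η * lamQ φ) + μplus - μminus = 0)
    (hcs : μminus * α = 0)
    (hqual : 0 < α) :
    piψ ≤ M / pψ
      + (∑ φ ∈ Φ, (-lamP φ - η * lamQ φ)) / ((Φ.card : ℝ) * Sbase * Δt) := by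
  have hN : (0 : ℝ) < Φ.card := by exact_mod_cast hΦ.card_pos
  have hμ : μminus = 0 := (mul_eq_zero.mp hcs).resolve_right hqual.ne'
  set c := pψ / (Sbase * (Φ.card : ℝ))
  have hc : 0 < c := by positivity
  have hp : ∀ φ ∈ Φ, pphase φ = c := fun φ hφ => by rw [hpphase, if_pos hφ]
  have hsum : ∑ φ ∈ Φ, pphase φ = Φ.card * c := by
    rw [Finset.sum_congr rfl hp, Finset.sum_const, nsmul_eq_mul]
  have hdual : ∑ φ ∈ Φ, pphase φ * (lamP φ + η * lamQ φ)
      = c * ∑ φ ∈ Φ, (lamP φ + η * lamQ φ) := by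
    rw [Finset.mul_sum]
    exact Finset.sum_congr rfl fun φ hφ => by rw [hp φ hφ]
  have hneg : ∑ φ ∈ Φ, (-lamP φ - η * lamQ φ) = -∑ φ ∈ Φ, (lamP φ + η * lamQ φ) := by
    rw [← Finset.sum_neg_distrib]
    exact Finset.sum_congr rfl fun φ _ => by ring
  rw [hsum, hdual, hμ] at hstat
  rw [hneg, ← sub_le_iff_le_add', le_div_iff₀ (by positivity)]
  refine le_of_mul_le_mul_left ?_ hc
  linarith
end

section
/- (Bin A, bids) Let ψ be a bidding DER (p(ψ) < 0) connected at bus i, cleared with fraction α_A(ψ) > 0 in the bids-only T-DOPF (Bin A), whose power-balance dual multipliers at bus i, phase φ are λ^p_{A,i,φ} and λ^q_{A,i,φ}. Suppose there exist μ⁺ ≥ 0, μ⁻ ≥ 0 with π(ψ)·(Σ_{φ∈Φ(ψ)} p^φ(ψ))·S_base·Δt + Σ_{φ∈Φ(ψ)} p^φ(ψ)·(λ^p_{A,i,φ} + η(ψ)·λ^q_{A,i,φ}) + μ⁺ − μ⁻ = 0 and μ⁻·α_A(ψ) = 0. Then π^QP(ψ) ≤ π(ψ), where π^QP(ψ) :=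 Σ_{φ∈Φ(ψ)} (−λ^p_{A,i,φ} − η(ψ)·λ^q_{A,i,φ}) / (N_φ·S_base·Δt). -/
/-- Bin A, bids: For a bidding DER (`pψ < 0`) cleared with fraction
`α_A(ψ) > 0` in the bids-only T-DOPF, with Bin-A power-balance dual multipliers
`λ^p_{A,i,φ}`, `λ^q_{A,i,φ}`, KKT stationarity and complementary slackness imply
that the Bin-A qualification price is at most the bid price. -/
theorem binA_qualified_bid_price_ge_qualification_price
    (Φ : Finset (Fin 3)) (hΦ : Φ.Nonempty)
    (piψ pψ Sbase Δt η : ℝ)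
    (lamPA lamQA : Fin 3 → ℝ)
    (hbid : pψ < 0) (hpi : 0 ≤ piψ) (hS : 0 < Sbase) (hΔt : 0 < Δt) (hη : 0 ≤ η)
    (pphase : Fin 3 → ℝ)
    (hpphase : ∀ φ : Fin 3, pphase φ =
      if φ ∈ Φ then pψ / (Sbase * (Φ.card : ℝ)) else 0)
    (αA μplus μminus : ℝ)
    (hα0 : 0 ≤ αA) (hα1 : αA ≤ 1) (hμplus : 0 ≤ μplus) (hμminus : 0 ≤ μminus)
    (hstat : piψ * (∑ φ ∈ Φ, pphase φ) * Sbase * Δt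
        + ∑ φ ∈ Φ, pphase φ * (lamPA φ + η * lamQA φ) + μplus - μminus = 0)
    (hcs : μminus * αA = 0)
    (hqual : 0 < αA) :
    (∑ φ ∈ Φ, (-lamPA φ - η * lamQA φ)) / ((Φ.card : ℝ) * Sbase * Δt) ≤ piψ := by
  have hN : (0 : ℝ) < Φ.card := by exact_mod_cast hΦ.card_pos
  have hμ : μminus = 0 := (mul_eq_zero.mp hcs).resolve_right hqual.ne'
  set c : ℝ := pψ / (Sbase * (Φ.card : ℝ))
  have hc : c < 0 := div_neg_of_neg_of_pos hbid (mul_pos hS hN)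
  have hp : ∀ φ ∈ Φ, pphase φ = c := fun φ hφ => by rw [hpphase, if_pos hφ]
  have hsum : ∑ φ ∈ Φ, pphase φ = Φ.card * c := by
    rw [Finset.sum_congr rfl hp, Finset.sum_const, nsmul_eq_mul]
  have hdual : ∑ φ ∈ Φ, pphase φ * (lamPA φ + η * lamQA φ)
      = c * ∑ φ ∈ Φ, (lamPA φ + η * lamQA φ) := by
    rw [Finset.mul_sum]
    exact Finset.sum_congr rfl fun φ hφ => by rw [hp φ hφ]
  have hneg : ∑ φ ∈ Φ, (-lamPA φ - η * lamQA φ) = -∑ φ ∈ Φ, (lamPA φ + η * lamQA φ) := by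
    rw [← Finset.sum_neg_distrib]
    exact Finset.sum_congr rfl fun φ _ => by ring
  rw [hsum, hdual, hμ] at hstat
  rw [hneg, div_le_iff₀ (by positivity)]
  have hnonneg : 0 ≤ piψ * (Φ.card * Sbase * Δt) + ∑ φ ∈ Φ, (lamPA φ + η * lamQA φ) :=
    nonneg_of_mul_nonpos_right (by linarith) hc
  linarith
end

section
/- (Bin B, offers) Let ψ be an offering DER (p(ψ) > 0) connected at bus i, let M be a real number, cleared with fraction α_B(ψ) > 0 in the offers-only T-DOPF (Bin B), whose power-balance dual multipliers at bus i, phase φ are λ^p_{B,i,φ} and λ^q_{B,i,φ}. Suppose there exist μ⁺ ≥ 0, μ⁻ ≥ 0 with (π(ψ) − M/p(ψ))·(Σ_{φ∈Φ(ψ)} p^φ(ψ))·S_base·Δt + Σ_{φ∈Φ(ψ)} p^φ(ψ)·(λ^p_{B,i,φ} + η(ψ)·λ^q_{B,i,φ}) + μ⁺ − μ⁻ = 0 and μ⁻·α_B(ψ) = 0. Then π(ψ) ≤ π^QP(ψ), where π^QP(ψ) := M/p(ψ) + Σ_{φ∈Φ(ψ)} (−λ^p_{B,i,φ} − η(ψ)·λ^q_{B,i,φ})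 / (N_φ·S_base·Δt). -/
/-- Bin B, offers: For an offering DER (`pψ > 0`) cleared with
fraction `α_B(ψ) > 0` in the offers-only T-DOPF, with Bin-B power-balance dual
multipliers `λ^p_{B,i,φ}`, `λ^q_{B,i,φ}`, KKT stationarity and complementary
slackness imply that the offer price is at most the Bin-B qualification price. -/
theorem binB_qualified_offer_price_le_qualification_price
    (Φ : Finset (Fin 3)) (hΦ : Φ.Nonempty)
    (piψ pψ Sbase Δt η M : ℝ)
    (lamPB lamQB : Fin 3 → ℝ)
    (hoffer : 0 < pψ) (hpi : 0 ≤ piψ) (hS : 0 < Sbase) (hΔt : 0 < Δt) (hη : 0 ≤ η)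
    (pphase : Fin 3 → ℝ)
    (hpphase : ∀ φ : Fin 3, pphase φ =
      if φ ∈ Φ then pψ / (Sbase * (Φ.card : ℝ)) else 0)
    (αB μplus μminus : ℝ)
    (hα0 : 0 ≤ αB) (hα1 : αB ≤ 1) (hμplus : 0 ≤ μplus) (hμminus : 0 ≤ μminus)
    (hstat : (piψ - M / pψ) * (∑ φ ∈ Φ, pphase φ) * Sbase * Δt
        + ∑ φ ∈ Φ, pphase φ * (lamPB φ + η * lamQB φ) + μplus - μminus = 0)
    (hcs : μminus * αB = 0)
    (hqual : 0 < αB) :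
    piψ ≤ M / pψ
      + (∑ φ ∈ Φ, (-lamPB φ - η * lamQB φ)) / ((Φ.card : ℝ) * Sbase * Δt) := by
  have hcard : (0 : ℝ) < Φ.card := by exact_mod_cast hΦ.card_pos
  have hμ : μminus = 0 := (mul_eq_zero.mp hcs).resolve_right hqual.ne'
  obtain ⟨c, hc⟩ : ∃ c, c = pψ / (Sbase * (Φ.card : ℝ)) := ⟨_, rfl⟩
  have hcpos : 0 < c := by rw [hc]; positivity
  have hphase : ∀ φ ∈ Φ, pphase φ = c := fun φ hφ => by rw [hpphase, if_pos hφ, hc]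
  have hsum : ∑ φ ∈ Φ, pphase φ = Φ.card * c := by
    rw [Finset.sum_congr rfl hphase, Finset.sum_const, nsmul_eq_mul]
  have hdual : ∑ φ ∈ Φ, pphase φ * (lamPB φ + η * lamQB φ)
      = c * ∑ φ ∈ Φ, (lamPB φ + η * lamQB φ) := by
    rw [Finset.mul_sum]
    exact Finset.sum_congr rfl fun φ hφ => by rw [hphase φ hφ]
  have hneg : ∑ φ ∈ Φ, (-lamPB φ - η * lamQB φ) = -∑ φ ∈ Φ, (lamPB φ + η * lamQB φ) := by
    rw [← Finset.sum_neg_distrib]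
    exact Finset.sum_congr rfl fun φ _ => by ring
  rw [hsum, hdual, hμ] at hstat
  rw [hneg, ← sub_le_iff_le_add', le_div_iff₀ (by positivity)]
  refine le_of_mul_le_mul_left ?_ hcpos
  linarith
end
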